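/- Let R be an elementary divisor domain, W a nonzero element of R, and let (u, v) and (u', v') be matrix factorizations of W of reduced ranks ρ and ρ' respectively (u·v = v·u = W·I_ρ and u'·v' = v'·u' = W·I_{ρ'}). Then the two factorizations are strongly isomorphic — i.e. ρ = ρ' and there exist invertible matrices A, B ∈ GL(ρ,R) with v'·B = A·v and u'·A = B·u — if and only if ρ = ρ' and for every k with 1 ≤ k ≤ ρ the ideal I_k(v) of R generated by all k×k minors of v equals the ideal I_k(v') generated by all k×k minors of v'. -/

import Mathlib

/-- An elementary divisor domain: for all `a b c` there exist `p q x y` such that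
`p·x·a + p·y·b + q·y·c` is a greatest common divisor of `a`, `b` and `c`. -/
def IsEDD (R : Type*) [CommRing R] : Prop :=
  ∀ a b c : R, ∃ p q x y : R,
    (p * x * a + p * y * b + q * y * c ∣ a) ∧
    (p * x * a + p * y * b + q * y * c ∣ b) ∧
    (p * x * a + p * y * b + q * y * c ∣ c) ∧
    ∀ d : R, d ∣ a → d ∣ b → d ∣ c → d ∣ p * x * a + p * y * b + q * y * c

/-- The ideal of `R` generated by all `k×k` minors of a square matrix `v`. -/
def minorsIdeal {R : Type*} [CommRing R] {m : ℕ} (v : Matrix (Fin m) (Fin m) R)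
    (k : ℕ) : Ideal R :=
  Ideal.span {x : R | ∃ f g : Fin k → Fin m,
    Function.Injective f ∧ Function.Injective g ∧ x = (v.submatrix f g).det}

open Matrix

section EDD
variable {R : Type*} [CommRing R]

theorem minorsIdeal_mul_le_right {m : ℕ} (A M : Matrix (Fin m) (Fin m) R) (k : ℕ) :
    minorsIdeal (A * M) k ≤ minorsIdeal M k := by
  refine Ideal.span_le.2 ?_
  rintro _ ⟨f, g, -, hg, rfl⟩
  have h : ((A * M).submatrix f g).det =
      ∑ r : Fin k → Fin m, (∏ i, A (f i) (r i)) * (M.submatrix r g).det := by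
    have h1 : (A * M).submatrix f g =
        fun i => ∑ l, A (f i) l • fun j => M l (g j) := by
      ext i j
      simp [Matrix.mul_apply]
    rw [h1]
    change Matrix.detRowAlternating.toMultilinearMap _ = _
    rw [MultilinearMap.map_sum]
    refine Finset.sum_congr rfl fun r _ => ?_
    rw [MultilinearMap.map_smul_univ]
    rfl
  rw [SetLike.mem_coe, h]
  refine Ideal.sum_mem _ fun r _ => Ideal.mul_mem_left _ _ ?_
  by_cases hr : Function.Injective r
  · exact Ideal.subset_span ⟨r, g, hr, hg, rfl⟩
  · obtain ⟨i, j, hij, hne⟩ : ∃ i j, r i = r j ∧ i ≠ j := by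
      simpa [Function.Injective] using hr
    rw [Matrix.det_zero_of_row_eq hne (by ext l; simp [hij])]
    exact zero_mem _

theorem minorsIdeal_transpose {m : ℕ} (M : Matrix (Fin m) (Fin m) R) (k : ℕ) :
    minorsIdeal Mᵀ k = minorsIdeal M k := by
  have h : ∀ N : Matrix (Fin m) (Fin m) R, minorsIdeal Nᵀ k ≤ minorsIdeal N k := by
    refine fun N => Ideal.span_mono ?_
    rintro _ ⟨f, g, hf, hg, rfl⟩
    exact ⟨g, f, hg, hf, by rw [← Matrix.det_transpose, Matrix.transpose_submatrix,
      Matrix.transpose_transpose]⟩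
  exact (h M).antisymm (by simpa using h Mᵀ)

theorem minorsIdeal_isUnit_mul {m : ℕ} {A : Matrix (Fin m) (Fin m) R} (hA : IsUnit A.det)
    (M : Matrix (Fin m) (Fin m) R) (k : ℕ) : minorsIdeal (A * M) k = minorsIdeal M k := by
  refine (minorsIdeal_mul_le_right A M k).antisymm ?_
  simpa [Matrix.nonsing_inv_mul_cancel_left _ _ hA] using
    minorsIdeal_mul_le_right A⁻¹ (A * M) k

theorem minorsIdeal_mul_isUnit {m : ℕ} {B : Matrix (Fin m) (Fin m) R} (hB : IsUnit B.det)
    (M : Matrix (Fin m) (Fin m) R) (k : ℕ) : minorsIdeal (M * B) k = minorsIdeal M k := by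
  rw [← minorsIdeal_transpose, Matrix.transpose_mul,
    minorsIdeal_isUnit_mul (by rwa [Matrix.det_transpose]), minorsIdeal_transpose]

/-- For a chain `d 0 ∣ d 1 ∣ ⋯`, the product of the first `k` terms divides every product of
`k` distinct terms. -/
theorem prod_castLE_dvd_prod_of_injective {m k : ℕ} (hk : k ≤ m) {d : Fin m → R}
    (hd : ∀ i j, i ≤ j → d i ∣ d j) {g : Fin k → Fin m} (hg : Function.Injective g) :
    ∏ i : Fin k, d (Fin.castLE hk i) ∣ ∏ i, d (g i) := by
  classical
  have hcard : (Finset.univ.image g).card = k := by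
    simp [Finset.card_image_of_injective _ hg]
  set h := (Finset.univ.image g).orderEmbOfFin hcard
  have h1 : ∏ i, d (g i) = ∏ i, d (h i) := by
    rw [← Finset.prod_image (s := Finset.univ) (g := g) (f := d) hg.injOn,
      ← Finset.image_orderEmbOfFin_univ _ hcard,
      Finset.prod_image h.injective.injOn]
  rw [h1]
  refine Finset.prod_dvd_prod_of_dvd _ _ fun i _ => hd _ _ ?_
  have hle : ∀ n (hn : n < k), n ≤ (h ⟨n, hn⟩ : ℕ) := by
    intro n
    induction n with
    | zero => simp
    | succ n ih =>
      intro hn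
      have h2 : h ⟨n, by omega⟩ < h ⟨n + 1, hn⟩ := h.strictMono (Fin.mk_lt_mk.2 n.lt_succ_self)
      have := ih (by omega)
      have := Fin.lt_def.1 h2
      omega
  exact Fin.le_def.2 (hle i i.isLt)

theorem minorsIdeal_diagonal {m k : ℕ} (hk : k ≤ m) {d : Fin m → R}
    (hd : ∀ i j, i ≤ j → d i ∣ d j) :
    minorsIdeal (Matrix.diagonal d) k = Ideal.span {∏ i : Fin k, d (Fin.castLE hk i)} := by
  refine le_antisymm (Ideal.span_le.2 ?_) (Ideal.span_le.2 ?_)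
  · rintro _ ⟨f, g, -, hg, rfl⟩
    have h : (Matrix.diagonal d).submatrix f g =
        (1 : Matrix (Fin m) (Fin m) R).submatrix f g * Matrix.diagonal (d ∘ g) := by
      ext i j
      by_cases h : f i = g j <;> 
        simp [Matrix.mul_diagonal, Matrix.one_apply, h]
    rw [SetLike.mem_coe, Ideal.mem_span_singleton, h, Matrix.det_mul, Matrix.det_diagonal]
    exact (prod_castLE_dvd_prod_of_injective hk hd hg).mul_left _
  · rw [Set.singleton_subset_iff]
    refine Ideal.subset_span ⟨Fin.castLE hk, Fin.castLE hk, Fin.castLE_injective hk,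
      Fin.castLE_injective hk, ?_⟩
    rw [Matrix.submatrix_diagonal _ _ (Fin.castLE_injective hk), Matrix.det_diagonal]
    rfl

theorem associated_of_associated_prod_castLE [IsDomain R] {m : ℕ} {d d' : Fin m → R}
    (h0 : ∀ i, d i ≠ 0)
    (h : ∀ k, ∀ hk : k ≤ m, Associated (∏ i : Fin k, d (Fin.castLE hk i))
      (∏ i : Fin k, d' (Fin.castLE hk i))) (i : Fin m) : Associated (d i) (d' i) := by
  have h1 := h (i + 1) i.isLt
  rw [Fin.prod_univ_castSucc, Fin.prod_univ_castSucc] at h1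
  exact Associated.of_mul_left h1 (h i i.isLt.le) (Finset.prod_ne_zero_iff.2 fun j _ => h0 _)

theorem IsEDD.isBezout (hR : IsEDD R) : IsBezout R := by
  refine IsBezout.iff_span_pair_isPrincipal.2 fun a b => ?_
  obtain ⟨p, q, x, y, ha, hb, -, -⟩ := hR a b b
  refine ⟨p * x * a + p * y * b + q * y * b, le_antisymm (Ideal.span_le.2 ?_) ?_⟩
  · rintro _ (rfl | rfl)
    · exact Ideal.mem_span_singleton.2 ha
    · exact Ideal.mem_span_singleton.2 hb
  · refine (Ideal.span_singleton_le_iff_mem _).2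
      (Ideal.mem_span_pair.2 ⟨p * x, p * y + q * y, by ring⟩)

theorem IsBezout.exists_sum_mul_dvd [IsBezout R] {ι : Type*} [Fintype ι] (a : ι → R) :
    ∃ c : ι → R, ∀ j, ∑ i, c i * a i ∣ a j := by
  have hp : (Ideal.span (Set.range a)).IsPrincipal :=
    IsBezout.isPrincipal_of_FG _ (Submodule.fg_span (Set.finite_range a))
  obtain ⟨g, hg⟩ := hp
  have hg' : g ∈ Ideal.span (Set.range a) := hg ▸ Submodule.mem_span_singleton_self g
  obtain ⟨c, hc⟩ := (Submodule.mem_span_range_iff_exists_fun R).1 hg'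
  refine ⟨c, fun j => ?_⟩
  have : a j ∈ Ideal.span {g} := by
    rw [← Ideal.submodule_span_eq, ← hg]
    exact Ideal.subset_span ⟨j, rfl⟩
  rw [Ideal.mem_span_singleton] at this
  simpa [← hc] using this

/-- Over an elementary divisor ring, the gcd of the entries of a matrix `M` is a value of the
bilinear form `(p, x) ↦ p ⬝ᵥ M *ᵥ x`. -/
theorem IsEDD.exists_dotProduct_mulVec_dvd (hR : IsEDD R) {n : ℕ} :
    ∀ {m : ℕ} (M : Matrix (Fin m) (Fin n) R),
      ∃ (p : Fin m → R) (x : Fin n → R), ∀ i j, p ⬝ᵥ M *ᵥ x ∣ M i j := by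
  have := hR.isBezout
  intro m
  induction m with
  | zero => exact fun M => ⟨0, 0, fun i => i.elim0⟩
  | succ m ih =>
    intro M
    obtain ⟨p', x', h'⟩ := ih (M.submatrix Fin.succ id)
    set M' := M.submatrix Fin.succ id
    set g := p' ⬝ᵥ M' *ᵥ x' with hg
    have hω : ∀ j, ∃ w, (p' ᵥ* M') j = g * w := fun j =>
      (Finset.dvd_sum fun i _ => (h' i j).mul_left (p' i) : g ∣ ∑ i, p' i * M' i j)
    choose ω hω using hω
    -- if `g ≠ 0`, the vectors `e_j - ω j • x'` span the kernel of `p' ᵥ* M'`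
    obtain ⟨c, hc⟩ := IsBezout.exists_sum_mul_dvd fun j => M 0 j - ω j * (M 0 ⬝ᵥ x')
    set z : Fin n → R := c - (ω ⬝ᵥ c) • x' with hz
    have hrz : M 0 ⬝ᵥ z = ∑ i, c i * (M 0 i - ω i * (M 0 ⬝ᵥ x')) := by
      simp only [hz, dotProduct_sub, dotProduct_smul, smul_eq_mul, mul_sub,
        Finset.sum_sub_distrib]
      congr 1
      · exact dotProduct_comm _ _
      · simp only [dotProduct, Finset.sum_mul]
        exact Finset.sum_congr rfl fun i _ => by ring
    have hwz : p' ⬝ᵥ M' *ᵥ z = 0 := by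
      have : p' ᵥ* M' = g • ω := by ext j; simp [hω]
      rw [hz, mulVec_sub, dotProduct_sub, mulVec_smul, dotProduct_smul, ← hg,
        dotProduct_mulVec, this, smul_dotProduct]
      simp [mul_comm]
    obtain ⟨p, q, t, s, ha, hb, hgd, -⟩ := hR (M 0 ⬝ᵥ z) (M 0 ⬝ᵥ x') g
    have hval : Fin.cons p (q • p') ⬝ᵥ M *ᵥ (t • z + s • x') =
        p * t * (M 0 ⬝ᵥ z) + p * s * (M 0 ⬝ᵥ x') + q * s * g := by
      have hM : M *ᵥ (t • z + s • x') =
          Fin.cons (M 0 ⬝ᵥ (t • z + s • x')) (M' *ᵥ (t • z + s • x')) := by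
        ext i
        refine Fin.cases rfl (fun i => rfl) i
      rw [hM]
      have : ∀ (a b : R) (v w : Fin m → R),
          (Fin.cons a v : Fin (m + 1) → R) ⬝ᵥ (Fin.cons b w : Fin (m + 1) → R) =
            a * b + v ⬝ᵥ w := fun a b v w => by
        simp [dotProduct, Fin.sum_univ_succ]
      rw [this, mulVec_add, mulVec_smul, mulVec_smul]
      simp only [dotProduct_add, dotProduct_smul, smul_dotProduct, hwz, ← hg, smul_eq_mul]
      ring
    refine ⟨Fin.cons p (q • p'), t • z + s • x', fun i j => ?_⟩
    rw [hval]
    refine Fin.cases ?_ (fun i => hgd.trans (h' i j)) i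
    have h1 := ha.trans (hrz ▸ hc j)
    simpa using dvd_add h1 (hb.mul_left (ω j))

/-- An invertible matrix acting only on the coordinates `i₀` and `j` can kill the latter. -/
theorem Matrix.exists_isUnit_det_mulVec_eq_zero [IsDomain R] [IsBezout R] {ι : Type*} [Fintype ι]
    [DecidableEq ι] {i₀ j : ι} (hj : i₀ ≠ j) (v : ι → R) :
    ∃ P : Matrix ι ι R, IsUnit P.det ∧ (P *ᵥ v) j = 0 ∧
      ∀ i, i ≠ i₀ → i ≠ j → (P *ᵥ v) i = v i := by
  obtain ⟨E, hE, h1⟩ : ∃ E : Matrix (Fin 2) (Fin 2) R, E.det = 1 ∧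
      E 1 0 * v i₀ + E 1 1 * v j = 0 := by
    obtain ⟨c, hc⟩ := IsBezout.exists_sum_mul_dvd ![v i₀, v j]
    set g := ∑ i, c i * ![v i₀, v j] i with hg
    obtain ⟨α, hα⟩ : g ∣ v i₀ := hc 0
    obtain ⟨γ, hγ⟩ : g ∣ v j := hc 1
    simp only [Fin.sum_univ_two, Matrix.cons_val_zero, Matrix.cons_val_one] at hg
    by_cases h0 : g = 0
    · exact ⟨1, by simp, by simp [hγ, h0]⟩
    · refine ⟨!![c 0, c 1; -γ, α], ?_, ?_⟩
      · rw [Matrix.det_fin_two_of]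
        refine mul_left_cancel₀ h0 ?_
        linear_combination (-c 0) * hα - c 1 * hγ - hg
      · simp only [Matrix.of_apply, Matrix.cons_val_zero, Matrix.cons_val_one, Matrix.cons_val',
          Matrix.cons_val_fin_one]
        linear_combination (-γ) * hα + α * hγ
  obtain ⟨S, hS0, hS1⟩ : ∃ S : Matrix ι (Fin 2) R,
      (∀ i, S i 0 = if i = i₀ then 1 else 0) ∧ ∀ i, S i 1 = if i = j then 1 else 0 :=
    ⟨Matrix.of fun i a => if i = ![i₀, j] a then 1 else 0, fun _ => rfl, fun _ => rfl⟩
  have hSS : Sᵀ * S = 1 := by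
    ext a b
    fin_cases a <;> fin_cases b <;> simp [hS0, hS1, Matrix.mul_apply, hj, hj.symm]
  have hSv : Sᵀ *ᵥ v = ![v i₀, v j] := by
    ext a
    fin_cases a <;> simp [hS0, hS1, Matrix.mulVec, dotProduct]
  have hact : ∀ i, ((1 + S * ((E - 1) * Sᵀ)) *ᵥ v) i =
      v i + (S i 0 * ((E 0 0 - 1) * v i₀ + E 0 1 * v j) +
        S i 1 * (E 1 0 * v i₀ + (E 1 1 - 1) * v j)) := by
    intro i
    rw [Matrix.add_mulVec, Matrix.one_mulVec, ← Matrix.mulVec_mulVec, ← Matrix.mulVec_mulVec, hSv]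
    simp [Matrix.mulVec, dotProduct, Fin.sum_univ_two]
  refine ⟨1 + S * ((E - 1) * Sᵀ), ?_, ?_, fun i hi hij => ?_⟩
  · rw [Matrix.det_one_add_mul_comm, Matrix.mul_assoc, hSS, mul_one, add_sub_cancel, hE]
    exact isUnit_one
  · rw [hact, hS0, hS1, if_neg hj.symm, if_pos rfl]
    linear_combination h1
  · simp [hact, hS0, hS1, hi, hij]

theorem Matrix.exists_isUnit_det_mulVec_eq_single [IsDomain R] [IsBezout R] {ι : Type*}
    [Fintype ι] [DecidableEq ι] (i₀ : ι) (v : ι → R) :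
    ∃ (P : Matrix ι ι R) (c : R), IsUnit P.det ∧ P *ᵥ v = Pi.single i₀ c := by
  have key : ∀ s : Finset ι, i₀ ∉ s → ∃ P : Matrix ι ι R, IsUnit P.det ∧
      ∀ i ∈ s, (P *ᵥ v) i = 0 := by
    intro s
    induction s using Finset.induction_on with
    | empty => exact fun _ => ⟨1, by simp, by simp⟩
    | insert j s hjs ih =>
      intro hi
      simp only [Finset.mem_insert, not_or] at hi
      obtain ⟨P, hP, hPs⟩ := ih hi.2
      obtain ⟨Q, hQ, hQj, hQi⟩ := Matrix.exists_isUnit_det_mulVec_eq_zero hi.1 (P *ᵥ v)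
      refine ⟨Q * P, by rw [Matrix.det_mul]; exact hQ.mul hP, fun i his => ?_⟩
      rw [← Matrix.mulVec_mulVec]
      by_cases hij : i = j
      · rw [hij, hQj]
      · have his : i ∈ s := (Finset.mem_insert.1 his).resolve_left hij
        rw [hQi i (fun h => hi.2 (h ▸ his)) hij, hPs i his]
  obtain ⟨P, hP, h⟩ := key (Finset.univ.erase i₀) (by simp)
  refine ⟨P, (P *ᵥ v) i₀, hP, funext fun i => ?_⟩
  by_cases hi : i = i₀
  · subst hi; simp
  · rw [Pi.single_eq_of_ne hi, h i (by simp [hi])]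

/-- Every vector over a Bézout domain is a multiple of a column of an invertible matrix. -/
theorem Matrix.exists_isUnit_det_eq_smul_col [IsDomain R] [IsBezout R] {ι : Type*} [Fintype ι]
    [DecidableEq ι] (i₀ : ι) (v : ι → R) :
    ∃ (Q : Matrix ι ι R) (c : R), IsUnit Q.det ∧ v = c • Q.col i₀ := by
  obtain ⟨P, c, hP, h⟩ := Matrix.exists_isUnit_det_mulVec_eq_single i₀ v
  refine ⟨P⁻¹, c, Matrix.isUnit_nonsing_inv_det _ hP, ?_⟩
  have : P⁻¹ *ᵥ (P *ᵥ v) = v := by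
    rw [Matrix.mulVec_mulVec, Matrix.nonsing_inv_mul _ hP, Matrix.one_mulVec]
  rw [← this, h]
  ext i
  simp [mul_comm]

/-- A matrix over an elementary divisor domain is equivalent to one in which a given entry
divides all the others. -/
theorem IsEDD.exists_equivalent_apply_dvd [IsDomain R] (hR : IsEDD R) {n : ℕ} (i₀ : Fin n)
    (M : Matrix (Fin n) (Fin n) R) :
    ∃ P Q : Matrix (Fin n) (Fin n) R, IsUnit P.det ∧ IsUnit Q.det ∧
      ∀ i j, (P * M * Q) i₀ i₀ ∣ (P * M * Q) i j := by
  have := hR.isBezout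
  obtain ⟨p, x, h⟩ := hR.exists_dotProduct_mulVec_dvd M
  obtain ⟨P, c, hP, rfl⟩ := Matrix.exists_isUnit_det_eq_smul_col i₀ p
  obtain ⟨Q, c', hQ, rfl⟩ := Matrix.exists_isUnit_det_eq_smul_col i₀ x
  refine ⟨Pᵀ, Q, by rwa [Matrix.det_transpose], hQ, fun i j => ?_⟩
  have h0 : (Pᵀ * M * Q) i₀ i₀ = P.col i₀ ⬝ᵥ M *ᵥ Q.col i₀ := by
    rw [Matrix.mul_assoc]
    rfl
  have h1 : ∀ i j, (Pᵀ * M * Q) i₀ i₀ ∣ M i j := fun i j => by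
    refine dvd_trans ?_ (h i j)
    rw [h0, Matrix.mulVec_smul, dotProduct_smul, smul_dotProduct, smul_eq_mul, smul_eq_mul]
    exact Dvd.dvd.mul_left (Dvd.dvd.mul_left dvd_rfl _) _
  change _ ∣ ∑ l, (∑ l', Pᵀ i l' * M l' l) * Q l j
  refine Finset.dvd_sum fun l _ => Dvd.dvd.mul_right ?_ _
  exact Finset.dvd_sum fun l' _ => (h1 _ _).mul_left _

/-- **Smith normal form** over an elementary divisor domain. -/
theorem IsEDD.exists_smith_normal_form [IsDomain R] (hR : IsEDD R) {n : ℕ}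
    (M : Matrix (Fin n) (Fin n) R) :
    ∃ (P Q : Matrix (Fin n) (Fin n) R) (d : Fin n → R), IsUnit P.det ∧ IsUnit Q.det ∧
      (∀ i j, i ≤ j → d i ∣ d j) ∧ M = P * Matrix.diagonal d * Q := by
  induction n with
  | zero => exact ⟨1, 1, 0, by simp, by simp, fun i => i.elim0, by ext i; exact i.elim0⟩
  | succ n ih =>
    obtain ⟨P, Q, hP, hQ, h⟩ := hR.exists_equivalent_apply_dvd 0 M
    set N := P * M * Q with hN
    set g := N 0 0 with hg
    have hN' : ∀ i j, ∃ c, N i j = g * c ∧ (i = 0 → j = 0 → c = 1) := by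
      intro i j
      by_cases hij : i = 0 ∧ j = 0
      · exact ⟨1, by simp [hij, hg], fun _ _ => rfl⟩
      · obtain ⟨c, hc⟩ := h i j
        exact ⟨c, hc, fun hi hj => absurd ⟨hi, hj⟩ hij⟩
    choose T hT hT0 using hN'
    let e : Fin (n + 1) ≃ Fin n ⊕ Unit := (finSuccEquiv n).trans (Equiv.optionEquivSumPUnit _)
    set T' : Matrix (Fin n ⊕ Unit) (Fin n ⊕ Unit) R :=
      (Matrix.of T).submatrix e.symm e.symm with hT'
    have h22 : T'.toBlocks₂₂ = 1 := by
      ext i j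
      exact (hT0 _ _ rfl rfl).trans (Matrix.one_apply_eq (α := R) ()).symm
    set B := T'.toBlocks₁₂
    set C := T'.toBlocks₂₁
    obtain ⟨P', Q', d, hP', hQ', hd, hdiag⟩ := ih (T'.toBlocks₁₁ - B * C)
    obtain ⟨L, U, hL, hU, hTT⟩ : ∃ L U : Matrix (Fin n ⊕ Unit) (Fin n ⊕ Unit) R,
        IsUnit L.det ∧ IsUnit U.det ∧
          T' = L * Matrix.fromBlocks (Matrix.diagonal d) 0 0 1 * U := by
      refine ⟨Matrix.fromBlocks P' B 0 1, Matrix.fromBlocks Q' 0 C 1,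
        by simpa using hP', by simpa using hQ', ?_⟩
      rw [← Matrix.fromBlocks_toBlocks T', h22]
      simp [Matrix.fromBlocks_multiply, ← hdiag, B, C]
    have hMinv : M = P⁻¹ * N * Q⁻¹ := by
      rw [hN, Matrix.mul_assoc P, Matrix.nonsing_inv_mul_cancel_left _ _ hP,
        Matrix.mul_nonsing_inv_cancel_right _ _ hQ]
    have hNT : N = g • T'.submatrix e e := by
      ext i j
      simp [hT', hT]
    have hD : (Matrix.fromBlocks (Matrix.diagonal d) 0 0 (1 : Matrix Unit Unit R)).submatrix e e =
        Matrix.diagonal (Fin.cons 1 d) := by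
      rw [← Matrix.diagonal_one, Matrix.fromBlocks_diagonal,
        Matrix.submatrix_diagonal _ _ e.injective]
      congr 1
      ext i
      refine Fin.cases ?_ (fun i => ?_) i <;> simp [e]
    refine ⟨P⁻¹ * L.submatrix e e, U.submatrix e e * Q⁻¹, g • Fin.cons 1 d, ?_, ?_, ?_, ?_⟩
    · rw [Matrix.det_mul, Matrix.det_submatrix_equiv_self]
      exact (Matrix.isUnit_nonsing_inv_det _ hP).mul hL
    · rw [Matrix.det_mul, Matrix.det_submatrix_equiv_self]
      exact hU.mul (Matrix.isUnit_nonsing_inv_det _ hQ)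
    · intro i j hij
      refine mul_dvd_mul_left g ?_
      revert hij
      refine Fin.cases (by simp) (fun i => ?_) i
      refine Fin.cases (by simp) (fun j hij => ?_) j
      exact hd i j (Fin.succ_le_succ_iff.1 hij)
    · rw [Matrix.diagonal_smul, ← hD]
      conv_lhs => rw [hMinv, hNT, hTT]
      simp only [← Matrix.submatrix_mul_equiv _ _ e e e, Matrix.mul_smul, Matrix.smul_mul,
        Matrix.mul_assoc]

/-- Nonsingular matrices over an elementary divisor domain are classified up to equivalence by
their determinantal ideals. -/
theorem IsEDD.exists_equivalent_of_minorsIdeal_eq [IsDomain R] (hR : IsEDD R) {n : ℕ}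
    {v v' : Matrix (Fin n) (Fin n) R} (hv : v.det ≠ 0)
    (h : ∀ k, 1 ≤ k → k ≤ n → minorsIdeal v k = minorsIdeal v' k) :
    ∃ A B : Matrix (Fin n) (Fin n) R, IsUnit A.det ∧ IsUnit B.det ∧ v' * B = A * v := by
  obtain ⟨P, Q, d, hP, hQ, hd, rfl⟩ := hR.exists_smith_normal_form v
  obtain ⟨P', Q', d', hP', hQ', hd', rfl⟩ := hR.exists_smith_normal_form v'
  have hd0 : ∀ i, d i ≠ 0 := by
    rw [Matrix.det_mul, Matrix.det_mul, Matrix.det_diagonal] at hv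
    exact fun i => Finset.prod_ne_zero_iff.1 (right_ne_zero_of_mul (left_ne_zero_of_mul hv)) i
      (Finset.mem_univ i)
  have hass := associated_of_associated_prod_castLE (d' := d') hd0 fun k hk => by
    rcases k.eq_zero_or_pos with rfl | hk0
    · simp
    · have := h k hk0 hk
      rwa [minorsIdeal_mul_isUnit hQ, minorsIdeal_isUnit_mul hP, minorsIdeal_mul_isUnit hQ',
        minorsIdeal_isUnit_mul hP', minorsIdeal_diagonal hk hd, minorsIdeal_diagonal hk hd',
        Ideal.span_singleton_eq_span_singleton] at this
  choose ε hε using fun i => (hass i).symm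
  have hdiag : Matrix.diagonal d' * Matrix.diagonal (fun i => (ε i : R)) = Matrix.diagonal d := by
    rw [Matrix.diagonal_mul_diagonal]
    exact congrArg _ (funext hε)
  have hεdet : IsUnit (Matrix.diagonal (fun i => (ε i : R))).det := by
    rw [Matrix.det_diagonal]
    exact ⟨∏ i, ε i, by simp⟩
  refine ⟨P' * P⁻¹, Q'⁻¹ * Matrix.diagonal (fun i => (ε i : R)) * Q, ?_, ?_, ?_⟩
  · rw [Matrix.det_mul]
    exact hP'.mul (Matrix.isUnit_nonsing_inv_det _ hP)
  · rw [Matrix.det_mul, Matrix.det_mul]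
    exact ((Matrix.isUnit_nonsing_inv_det _ hQ').mul hεdet).mul hQ
  · simp only [Matrix.mul_assoc, Matrix.nonsing_inv_mul_cancel_left _ _ hP,
      Matrix.mul_nonsing_inv_cancel_left _ _ hQ', ← hdiag]

end EDD

/-- Two matrix factorizations of a nonzero `W` over an elementary divisor domain are strongly
isomorphic iff they have the same reduced rank and the ideals generated by the `k×k` minors of
`v` and `v'` coincide for all `1 ≤ k ≤ ρ`. -/
theorem matrix_factorizations_strongly_isomorphic_iff_minors
    {R : Type*} [CommRing R] [IsDomain R] (hR : IsEDD R)
    (W : R) (hW : W ≠ 0) (ρ ρ' : ℕ)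
    (u v : Matrix (Fin ρ) (Fin ρ) R) (u' v' : Matrix (Fin ρ') (Fin ρ') R)
    (huv : u * v = W • (1 : Matrix (Fin ρ) (Fin ρ) R))
    (hvu : v * u = W • (1 : Matrix (Fin ρ) (Fin ρ) R))
    (huv' : u' * v' = W • (1 : Matrix (Fin ρ') (Fin ρ') R))
    (hvu' : v' * u' = W • (1 : Matrix (Fin ρ') (Fin ρ') R)) :
    (∃ h : ρ = ρ', ∃ A B : Matrix (Fin ρ') (Fin ρ') R,
      IsUnit A.det ∧ IsUnit B.det ∧
      v' * B = A * v.submatrix (Fin.cast h.symm) (Fin.cast h.symm) ∧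
      u' * A = B * u.submatrix (Fin.cast h.symm) (Fin.cast h.symm)) ↔
    (ρ = ρ' ∧ ∀ k : ℕ, 1 ≤ k → k ≤ ρ → minorsIdeal v k = minorsIdeal v' k) := by
  constructor
  · rintro ⟨rfl, A, B, hA, hB, hv, -⟩
    refine ⟨rfl, fun k _ _ => ?_⟩
    rw [← minorsIdeal_mul_isUnit hB v', hv, minorsIdeal_isUnit_mul hA]
    rfl
  · rintro ⟨rfl, h⟩
    have hdet : ∀ {M N : Matrix (Fin ρ) (Fin ρ) R},
        M * N = W • (1 : Matrix (Fin ρ) (Fin ρ) R) → M.det ≠ 0 := fun {M N} hMN => by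
      have := congrArg Matrix.det hMN
      rw [Matrix.det_mul, Matrix.det_smul, Matrix.det_one, mul_one] at this
      exact left_ne_zero_of_mul (this ▸ pow_ne_zero _ hW)
    obtain ⟨A, B, hA, hB, hAB⟩ := hR.exists_equivalent_of_minorsIdeal_eq (hdet hvu) h
    refine ⟨rfl, A, B, hA, hB, hAB, ?_⟩
    change u' * A = B * u
    have hcancel : v' * (u' * A) = v' * (B * u) := by
      rw [← mul_assoc, ← mul_assoc, hvu', hAB, mul_assoc, hvu]
      simp
    have := congrArg (u' * ·) hcancel
    simp only [← mul_assoc u' v', huv', smul_mul_assoc, one_mul] at this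
    exact smul_right_injective _ hW this
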